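/- arXiv:1610.09162 — 4 statements merged into one kernel-verified Lean document; each statement's English description precedes it below -/
import Mathlib

section
/- The topological transcendence degree is a monotonic invariant: for any tower of extensions of analytic fields L/L'/K'/K (i.e. K ⊆ K' ⊆ L' ⊆ L), one has topdeg(L'/K') ≤ topdeg(L/K). -/
open Metric

set_option linter.unusedSectionVars false

/-!
Ambient setting: every extension of analytic (complete, non-archimedean, real-valued)
fields `L/K` embeds isometrically into an algebraically closed, complete,
non-archimedean normed field `Ω` (e.g. the completed algebraic closure of `L`).
We therefore formalize analytic fields as closed subfields of such an ambient field `Ω`.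
-/

variable {Ω : Type*} [NormedField Ω] [CompleteSpace Ω] [IsUltrametricDist Ω] [IsAlgClosed Ω]

/-- The completion `hat{K(S)}` of the subfield generated by `K` and `S`, realized inside
the ambient analytic field `Ω` as the topological closure of the generated subfield. -/
noncomputable def hatGen (K : Subfield Ω) (S : Set Ω) : Subfield Ω :=
  (Subfield.closure ((K : Set Ω) ∪ S)).topologicalClosure

/-- `t` is topologically algebraic ("topgebraic") over `K`: it lies in the closure of the
set of elements algebraic over `K`, i.e. in the completed algebraic closure `hat{K^a}`. -/
def IsTopgebraicElem (K : Subfield Ω) (t : Ω) : Prop :=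
  t ∈ closure {x : Ω | IsAlgebraic K x}

/-- `t` is topologically transcendental over `K`. -/
def TopTranscendental (K : Subfield Ω) (t : Ω) : Prop := ¬ IsTopgebraicElem K t

/-- `S` is topgebraically independent over `K`: every `x ∈ S` is topologically
transcendental over `hat{K(S \ {x})}`. -/
def TopgebraicIndep (K : Subfield Ω) (S : Set Ω) : Prop :=
  ∀ x ∈ S, TopTranscendental (hatGen K (S \ {x})) x

/-- `S` topgebraically generates `L` over `K`: the extension `L / hat{K(S)}` is
topgebraic, i.e. `L` is contained in the completed algebraic closure of `hat{K(S)}`. -/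
def TopgebraicallyGenerates (K L : Subfield Ω) (S : Set Ω) : Prop :=
  (L : Set Ω) ⊆ closure {x : Ω | IsAlgebraic (hatGen K S) x}

/-- The topological transcendence degree of `L/K`: the least cardinal bounding the
cardinality of every topgebraically independent subset of `L`. -/
noncomputable def topdeg (K L : Subfield Ω) : Cardinal :=
  ⨆ S : {S : Set Ω // S ⊆ (L : Set Ω) ∧ TopgebraicIndep K S}, Cardinal.mk S.1

/-- The topgebraic generating degree of `L/K`: the least cardinality of a
topgebraically generating subset of `L` over `K`. -/
noncomputable def Topdeg (K L : Subfield Ω) : Cardinal :=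
  ⨅ S : {S : Set Ω // S ⊆ (L : Set Ω) ∧ TopgebraicallyGenerates K L S}, Cardinal.mk S.1

/-- The `K`-radius of `t`: the distance from `t` to the algebraic closure of `K`. -/
noncomputable def rad (K : Subfield Ω) (t : Ω) : ℝ :=
  Metric.infDist t {x : Ω | IsAlgebraic K x}

/-- The `K`-multiradius of an element `t` of `S`. -/
noncomputable def radS (K : Subfield Ω) (S : Set Ω) (t : Ω) : ℝ :=
  rad (hatGen K (S \ {t})) t

lemma mem_hatGen_of_mem {K : Subfield Ω} {S : Set Ω} {c : Ω} (hc : c ∈ K) : c ∈ hatGen K S :=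
  Subfield.le_topologicalClosure _ (Subfield.subset_closure (Or.inl hc))

lemma mem_hatGen_of_mem_set {K : Subfield Ω} {S : Set Ω} {t : Ω} (ht : t ∈ S) : t ∈ hatGen K S :=
  Subfield.le_topologicalClosure _ (Subfield.subset_closure (Or.inr ht))

lemma hatGen_mono {K K' : Subfield Ω} (h : K ≤ K') (S : Set Ω) : hatGen K S ≤ hatGen K' S :=
  closure_mono <| SetLike.coe_subset_coe.2 <|
    Subfield.closure_mono (Set.union_subset_union_left S h)

lemma IsTopgebraicElem.mono {K K' : Subfield Ω} (h : K ≤ K') {t : Ω}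
    (ht : IsTopgebraicElem K t) : IsTopgebraicElem K' t := by
  let _ := (Subfield.inclusion h).toAlgebra
  have : IsScalarTower K K' Ω := IsScalarTower.of_algebraMap_eq fun _ => rfl
  exact closure_mono (fun _ hx => IsAlgebraic.tower_top K' hx) ht

/-- Independence over a field descends to smaller base fields. -/
lemma TopgebraicIndep.of_le {K K' : Subfield Ω} (h : K ≤ K') {S : Set Ω}
    (hS : TopgebraicIndep K' S) : TopgebraicIndep K S :=
  fun x hx ht => hS x hx (ht.mono (hatGen_mono h _))

/-- Lemma 2.2.2: the topological transcendence degree is a monotonic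
invariant: for a tower of extensions of analytic fields `L/L'/K'/K` one has
`topdeg(L'/K') ≤ topdeg(L/K)`. -/
theorem topdeg_monotonic (K K' L' L : Subfield Ω)
    (hKc : IsClosed (K : Set Ω)) (hK'c : IsClosed (K' : Set Ω))
    (hL'c : IsClosed (L' : Set Ω)) (hLc : IsClosed (L : Set Ω))
    (hKK' : K ≤ K') (hK'L' : K' ≤ L') (hL'L : L' ≤ L) :
    topdeg K' L' ≤ topdeg K L := by
  have : Nonempty {S : Set Ω // S ⊆ (L' : Set Ω) ∧ TopgebraicIndep K' S} :=
    ⟨⟨∅, Set.empty_subset _, fun _ hx => hx.elim⟩⟩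
  refine ciSup_le fun S => ?_
  exact le_ciSup (f := fun T : {S : Set Ω // S ⊆ (L : Set Ω) ∧ TopgebraicIndep K S} =>
    Cardinal.mk T.1) ⟨Cardinal.mk Ω, Set.forall_mem_range.2 fun T => Cardinal.mk_set_le T.1⟩
    ⟨S.1, S.2.1.trans hL'L, S.2.2.of_le hKK'⟩
end

section
/- The topgebraic generating degree is a subadditive invariant: for any tower of extensions of analytic fields F/L/K, one has Topdeg(F/K) ≤ Topdeg(F/L) + Topdeg(L/K). -/
open Metric

set_option linter.unusedSectionVars false

/-!
Ambient setting: every extension of analytic (complete, non-archimedean, real-valued)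
fields `L/K` embeds isometrically into an algebraically closed, complete,
non-archimedean normed field `Ω` (e.g. the completed algebraic closure of `L`).
We therefore formalize analytic fields as closed subfields of such an ambient field `Ω`.
-/

variable {Ω : Type*} [NormedField Ω] [CompleteSpace Ω] [IsUltrametricDist Ω] [IsAlgClosed Ω]

lemma le_norm_eval_of_monic_of_roots {Ω : Type*} [NormedField Ω] [IsAlgClosed Ω]
    {x : Ω} {δ : ℝ} (hδ : 0 ≤ δ) {q : Polynomial Ω} (hq : q.Monic)
    (hroots : ∀ a ∈ q.roots, δ ≤ ‖x - a‖) : δ ^ q.natDegree ≤ ‖q.eval x‖ := by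
  have hs : q.Splits := IsAlgClosed.splits q
  rw [hs.eval_eq_prod_roots_of_monic hq, hs.natDegree_eq_card_roots]
  generalize q.roots = s at hroots
  induction s using Multiset.induction_on with
  | empty => simp
  | cons a s ih =>
    rw [Multiset.card_cons, pow_succ', Multiset.map_cons, Multiset.prod_cons, norm_mul]
    exact mul_le_mul (hroots a (Multiset.mem_cons_self a s))
      (ih fun b hb => hroots b (Multiset.mem_cons_of_mem hb)) (pow_nonneg hδ _) (norm_nonneg _)

lemma IsAlgebraic.of_subfield_le {E : Type*} [Field E] {M N : Subfield E} (h : M ≤ N) {x : E}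
    (hx : IsAlgebraic M x) : IsAlgebraic N x := by
  obtain ⟨p, hp, hpx⟩ := hx
  refine ⟨p.map (Subfield.inclusion h),
    (Polynomial.map_ne_zero_iff (Subfield.inclusion h).injective).2 hp, ?_⟩
  rw [Polynomial.aeval_def, Polynomial.eval₂_map]
  exact hpx

lemma exists_coeff_of_isAlgebraic_subfield {E : Type*} [Field E] {M : Subfield E} {x : E}
    (hx : IsAlgebraic M x) :
    ∃ (n : ℕ) (c : Fin n → E), (∀ i, c i ∈ M) ∧ x ^ n + ∑ i, c i * x ^ (i : ℕ) = 0 := by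
  have hm := minpoly.monic hx.isIntegral
  refine ⟨(minpoly M x).natDegree, fun i => ((minpoly M x).coeff i : M), fun i => SetLike.coe_mem _,
    ?_⟩
  have h := minpoly.aeval M x
  rw [hm.as_sum] at h
  simp only [map_add, map_pow, map_sum, map_mul, Polynomial.aeval_X, Polynomial.aeval_C] at h
  rw [Finset.sum_range] at h
  exact h

open Polynomial in
/-- The topological closure of a relatively algebraically closed subfield of an algebraically
closed normed field is relatively algebraically closed. -/
lemma mem_topologicalClosure_of_isAlgebraic {Ω : Type*} [NormedField Ω] [IsAlgClosed Ω]
    {A : Subfield Ω} (hA : ∀ x, IsAlgebraic A x → x ∈ A) {x : Ω}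
    (hx : IsAlgebraic A.topologicalClosure x) : x ∈ A.topologicalClosure := by
  by_contra hmem
  obtain ⟨δ, hδ, hdist⟩ : ∃ δ > 0, ∀ a ∈ A, δ ≤ ‖x - a‖ := by
    have h : x ∉ closure (A : Set Ω) := hmem
    rw [Metric.mem_closure_iff] at h
    push Not at h
    obtain ⟨δ, hδ, h⟩ := h
    exact ⟨δ, hδ, fun a ha => dist_eq_norm x a ▸ h a ha⟩
  obtain ⟨n, c, hc, hcx⟩ := exists_coeff_of_isAlgebraic_subfield hx
  have hsub : Set.pi Set.univ (fun _ : Fin n => (A : Set Ω)) ⊆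
      {c : Fin n → Ω | δ ^ n ≤ ‖x ^ n + ∑ i, c i * x ^ (i : ℕ)‖} := by
    intro d hd
    have hd' : ∀ i, d i ∈ A := fun i => hd i (Set.mem_univ i)
    let r : Polynomial A := ∑ i : Fin n, C ⟨d i, hd' i⟩ * X ^ (i : ℕ)
    have hr : r.degree < n := by
      refine (degree_sum_le _ _).trans_lt ((Finset.sup_lt_iff (WithBot.bot_lt_coe n)).2 ?_)
      intro i _
      exact (degree_C_mul_X_pow_le _ _).trans_lt (WithBot.coe_lt_coe.2 i.2)
    have hq : (X ^ n + r).Monic := monic_X_pow_add hr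
    have hdeg : (X ^ n + r).natDegree = n := natDegree_eq_of_degree_eq_some <| by
      rw [degree_add_eq_left_of_degree_lt (by rwa [degree_X_pow]), degree_X_pow]
    have key := le_norm_eval_of_monic_of_roots (x := x) hδ.le (hq.map A.subtype) fun a ha => by
      refine hdist a (hA a ⟨X ^ n + r, hq.ne_zero, ?_⟩)
      have := (mem_roots'.1 ha).2
      rwa [IsRoot.def, eval_map] at this
    rw [natDegree_map, hdeg] at key
    simpa [r, Polynomial.map_sum, eval_finsetSum] using key
  have hclosed : IsClosed {c : Fin n → Ω | δ ^ n ≤ ‖x ^ n + ∑ i, c i * x ^ (i : ℕ)‖} :=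
    isClosed_le continuous_const (by fun_prop)
  have hmemc : c ∈ closure (Set.pi Set.univ (fun _ : Fin n => (A : Set Ω))) := by
    rw [closure_pi_set]
    exact fun i _ => hc i
  have h := closure_minimal hsub hclosed hmemc
  rw [Set.mem_ofPred_eq, hcx, norm_zero] at h
  exact (pow_pos hδ n).not_ge h

/-- The completed algebraic closure of `M`, realized inside the ambient field. -/
noncomputable def topgebraicClosure (M : Subfield Ω) : Subfield Ω :=
  (algebraicClosure M Ω).toSubfield.topologicalClosure

lemma coe_topgebraicClosure (M : Subfield Ω) :
    (topgebraicClosure M : Set Ω) = closure {x : Ω | IsAlgebraic M x} := by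
  have h : ((algebraicClosure M Ω).toSubfield : Set Ω) = {x : Ω | IsAlgebraic M x} := by
    ext x
    exact mem_algebraicClosure_iff
  rw [← h]
  rfl

lemma le_topgebraicClosure (M : Subfield Ω) : M ≤ topgebraicClosure M := fun x hx => by
  rw [← SetLike.mem_coe, coe_topgebraicClosure]
  exact subset_closure (isAlgebraic_algebraMap (⟨x, hx⟩ : M))

lemma closure_isAlgebraic_mono {M N : Subfield Ω} (h : M ≤ N) :
    closure {x : Ω | IsAlgebraic M x} ⊆ closure {x : Ω | IsAlgebraic N x} :=
  closure_mono fun _ hx => hx.of_subfield_le h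

lemma mem_topgebraicClosure_of_isAlgebraic {M : Subfield Ω} {x : Ω}
    (hx : IsAlgebraic (topgebraicClosure M) x) : x ∈ topgebraicClosure M := by
  refine mem_topologicalClosure_of_isAlgebraic (fun y hy => ?_) hx
  change IsAlgebraic (algebraicClosure M Ω) y at hy
  exact mem_algebraicClosure_iff.2 (hy.restrictScalars M)

lemma hatGen_le {K M : Subfield Ω} {S : Set Ω} (hK : K ≤ M) (hS : S ⊆ M)
    (hM : IsClosed (M : Set Ω)) : hatGen K S ≤ M :=
  Subfield.topologicalClosure_minimal _ (Subfield.closure_le.2 (Set.union_subset hK hS)) hM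

lemma isClosed_hatGen (K : Subfield Ω) (S : Set Ω) : IsClosed (hatGen K S : Set Ω) :=
  Subfield.isClosed_topologicalClosure _

lemma TopgebraicallyGenerates.union {K L F : Subfield Ω} {S T : Set Ω}
    (hS : TopgebraicallyGenerates L F S) (hT : TopgebraicallyGenerates K L T) :
    TopgebraicallyGenerates K F (S ∪ T) := by
  set M := hatGen K (S ∪ T) with hM
  have hSM : S ⊆ M := fun s hs => mem_hatGen_of_mem_set (Or.inl hs)
  have hTM : hatGen K T ≤ M :=
    hatGen_le (fun _ => mem_hatGen_of_mem) (fun t ht => mem_hatGen_of_mem_set (Or.inr ht))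
      (isClosed_hatGen _ _)
  have hL : L ≤ topgebraicClosure M := by
    rw [← SetLike.coe_subset_coe, coe_topgebraicClosure]
    exact hT.trans (closure_isAlgebraic_mono hTM)
  have hclosed : IsClosed (topgebraicClosure M : Set Ω) := Subfield.isClosed_topologicalClosure _
  have hLS : hatGen L S ≤ topgebraicClosure M :=
    hatGen_le hL (hSM.trans (le_topgebraicClosure M)) hclosed
  rw [TopgebraicallyGenerates, ← hM, ← coe_topgebraicClosure]
  exact hS.trans (closure_minimal
    (fun _ hx => mem_topgebraicClosure_of_isAlgebraic (hx.of_subfield_le hLS)) hclosed)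

lemma topgebraicallyGenerates_self (K L : Subfield Ω) : TopgebraicallyGenerates K L L :=
  fun x hx => subset_closure
    (isAlgebraic_algebraMap (⟨x, mem_hatGen_of_mem_set hx⟩ : hatGen K (L : Set Ω)))

lemma exists_topgebraicallyGenerates_mk_eq_Topdeg (K L : Subfield Ω) :
    ∃ S : Set Ω, S ⊆ L ∧ TopgebraicallyGenerates K L S ∧ Cardinal.mk S = Topdeg K L := by
  have : Nonempty {S : Set Ω // S ⊆ (L : Set Ω) ∧ TopgebraicallyGenerates K L S} :=
    ⟨⟨L, subset_rfl, topgebraicallyGenerates_self K L⟩⟩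
  obtain ⟨S, hS⟩ := ciInf_mem
    fun S : {S : Set Ω // S ⊆ (L : Set Ω) ∧ TopgebraicallyGenerates K L S} => Cardinal.mk S.1
  exact ⟨S.1, S.2.1, S.2.2, hS⟩

/-- Lemma 2.2.4: the topgebraic generating degree is a subadditive
invariant: for a tower of extensions of analytic fields `F/L/K` one has
`Topdeg(F/K) ≤ Topdeg(F/L) + Topdeg(L/K)`. -/
theorem Topdeg_subadditive (K L F : Subfield Ω)
    (hKc : IsClosed (K : Set Ω)) (hLc : IsClosed (L : Set Ω)) (hFc : IsClosed (F : Set Ω))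
    (hKL : K ≤ L) (hLF : L ≤ F) :
    Topdeg K F ≤ Topdeg L F + Topdeg K L := by
  obtain ⟨S, hSF, hS, hScard⟩ := exists_topgebraicallyGenerates_mk_eq_Topdeg L F
  obtain ⟨T, hTL, hT, hTcard⟩ := exists_topgebraicallyGenerates_mk_eq_Topdeg K L
  rw [← hScard, ← hTcard]
  refine le_trans ?_ (Cardinal.mk_union_le S T)
  exact ciInf_le' (fun S : {S : Set Ω // S ⊆ (F : Set Ω) ∧ TopgebraicallyGenerates K F S} =>
    Cardinal.mk S.1) ⟨S ∪ T, Set.union_subset hSF (hTL.trans hLF), hS.union hT⟩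
end

section
/- Assume that L/K is an extension of analytic fields and t, t' ∈ L are elements with |t − t'| < r_K(t). Then there is a unique isometric K-isomorphism of analytic fields φ : hat{K(t)} ≅ hat{K(t')} such that φ(t) = t'. Moreover, for any α with |t − t'|/r_K(t) < α < 1, the embedding hat{K(t)} → L obtained by composing φ with the inclusion hat{K(t')} ⊆ L is an α-perturbation of the inclusion hat{K(t)} ⊆ L. -/
open Metric

set_option linter.unusedSectionVars false

/-!
Ambient setting: every extension of analytic (complete, non-archimedean, real-valued)
fields `L/K` embeds isometrically into an algebraically closed, complete,
non-archimedean normed field `Ω` (e.g. the completed algebraic closure of `L`).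
We therefore formalize analytic fields as closed subfields of such an ambient field `Ω`.
-/

variable {Ω : Type*} [NormedField Ω] [CompleteSpace Ω] [IsUltrametricDist Ω] [IsAlgClosed Ω]

open Polynomial in
lemma fieldRange_lift_eval₂ (K : Subfield Ω) (u : Ω)
    (hu : Function.Injective (eval₂RingHom K.subtype u)) :
    (IsFractionRing.lift hu : RatFunc K →+* Ω).fieldRange =
      Subfield.closure ((K : Set Ω) ∪ {u}) := by
  rw [IsFractionRing.lift_fieldRange]
  apply le_antisymm
  · rw [Subfield.closure_le]
    rintro _ ⟨P, rfl⟩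
    simp only [coe_eval₂RingHom, eval₂_eq_sum_range]
    have hmem : u ∈ Subfield.closure ((K : Set Ω) ∪ {u}) := Subfield.subset_closure (Or.inr rfl)
    exact sum_mem fun n _ => mul_mem (Subfield.subset_closure (Or.inl (P.coeff n).2))
      (pow_mem hmem n)
  · rw [Subfield.closure_le]
    rintro x (hx | rfl)
    · exact Subfield.subset_closure ⟨C ⟨x, hx⟩, by simp⟩
    · exact Subfield.subset_closure ⟨X, by simp⟩

lemma norm_le_of_norm_sub_le {β : ℝ} (hβ : β ≤ 1) {x x' : Ω} (h : ‖x - x'‖ ≤ β * ‖x‖) :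
    ‖x'‖ ≤ ‖x‖ := by
  have h1 : ‖x - x'‖ ≤ ‖x‖ := h.trans (mul_le_of_le_one_left (norm_nonneg _) hβ)
  calc ‖x'‖ = ‖(x' - x) + x‖ := by rw [sub_add_cancel]
    _ ≤ max ‖x' - x‖ ‖x‖ := IsUltrametricDist.norm_add_le_max _ _
    _ ≤ ‖x‖ := max_le (norm_sub_rev x x' ▸ h1) le_rfl

lemma norm_eq_of_norm_sub_le {β : ℝ} (hβ : β < 1) {x x' : Ω} (h : ‖x - x'‖ ≤ β * ‖x‖) :
    ‖x'‖ = ‖x‖ := by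
  refine le_antisymm (norm_le_of_norm_sub_le hβ.le h) ?_
  rcases eq_or_ne x 0 with rfl | hx
  · simp
  have h1 : ‖x - x'‖ < ‖x‖ := h.trans_lt (mul_lt_of_lt_one_left (norm_pos_iff.2 hx) hβ)
  have h2 : ‖x‖ ≤ max ‖x - x'‖ ‖x'‖ := by
    simpa using IsUltrametricDist.norm_add_le_max (x - x') x'
  exact (le_max_iff.1 h2).resolve_left h1.not_ge

lemma norm_mul_sub_mul_le {β : ℝ} (hβ : β ≤ 1) {x x' y y' : Ω}
    (hx : ‖x - x'‖ ≤ β * ‖x‖) (hy : ‖y - y'‖ ≤ β * ‖y‖) :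
    ‖x * y - x' * y'‖ ≤ β * ‖x * y‖ := by
  have e : x * y - x' * y' = (x - x') * y + x' * (y - y') := by ring
  rw [e, norm_mul x y]
  refine (IsUltrametricDist.norm_add_le_max _ _).trans (max_le ?_ ?_)
  · rw [norm_mul, ← mul_assoc]
    gcongr
  · rw [norm_mul]
    calc ‖x'‖ * ‖y - y'‖ ≤ ‖x‖ * (β * ‖y‖) := by
          gcongr
          exact norm_le_of_norm_sub_le hβ hx
      _ = β * (‖x‖ * ‖y‖) := by ring

lemma norm_div_sub_div_le {β : ℝ} (hβ : β < 1) {x x' y y' : Ω}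
    (hx : ‖x - x'‖ ≤ β * ‖x‖) (hy : ‖y - y'‖ ≤ β * ‖y‖) (hy0 : y ≠ 0) :
    ‖x / y - x' / y'‖ ≤ β * ‖x / y‖ := by
  have hn := norm_eq_of_norm_sub_le hβ hy
  have hpos : 0 < ‖y‖ := norm_pos_iff.2 hy0
  have hy0' : y' ≠ 0 := norm_pos_iff.1 (hn ▸ hpos)
  rw [div_eq_mul_inv, div_eq_mul_inv]
  refine norm_mul_sub_mul_le hβ.le hx ?_
  rw [inv_sub_inv hy0 hy0', norm_div, norm_mul, norm_inv, hn, norm_sub_rev,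
    div_le_iff₀ (mul_pos hpos hpos)]
  calc ‖y - y'‖ ≤ β * ‖y‖ := hy
    _ = β * ‖y‖⁻¹ * (‖y‖ * ‖y‖) := by field_simp

open Polynomial in
lemma norm_eval₂_sub_eval₂_le (K : Subfield Ω) {β : ℝ} (hβ0 : 0 ≤ β) (hβ : β ≤ 1) {t t' : Ω}
    (h : ∀ a : Ω, IsAlgebraic K a → dist t t' ≤ β * ‖t - a‖) (P : K[X]) :
    ‖P.eval₂ K.subtype t - P.eval₂ K.subtype t'‖ ≤ β * ‖P.eval₂ K.subtype t‖ := by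
  rcases eq_or_ne P 0 with rfl | hP
  · simp
  have hs := IsAlgClosed.splits (P.map K.subtype)
  rw [← eval_map, ← eval_map, hs.eval_eq_prod_roots, hs.eval_eq_prod_roots]
  refine norm_mul_sub_mul_le hβ (by simpa using by positivity) ?_
  have hroots : ∀ a ∈ (P.map K.subtype).roots, dist t t' ≤ β * ‖t - a‖ := fun a ha =>
    h a ⟨P, hP, by
      have := isRoot_of_mem_roots ha
      rwa [IsRoot.def, eval_map] at this⟩
  generalize (P.map K.subtype).roots = m at hroots
  induction m using Multiset.induction_on with
  | empty => simpa using hβ0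
  | cons a m ih =>
    simp only [Multiset.map_cons, Multiset.prod_cons]
    refine norm_mul_sub_mul_le hβ ?_ (ih fun b hb => hroots b (Multiset.mem_cons_of_mem hb))
    rw [sub_sub_sub_cancel_right, ← dist_eq_norm]
    exact hroots a (Multiset.mem_cons_self a m)

/-- Two embeddings of a field inducing the same absolute value have isometric completed images. -/
lemma exists_isometric_ringEquiv_of_norm_eq {F : Type*} [Field F] (i i' : F →+* Ω)
    (hn : ∀ f, ‖i' f‖ = ‖i f‖) {A B : Subfield Ω} (hA : i.fieldRange.topologicalClosure = A)
    (hB : i'.fieldRange.topologicalClosure = B) :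
    ∃ φ : A ≃+* B, (∀ x, ‖(φ x : Ω)‖ = ‖(x : Ω)‖) ∧
      ∀ (f : F) (hf : i f ∈ A), (φ ⟨i f, hf⟩ : Ω) = i' f := by
  have hiA : ∀ f, i f ∈ A := fun f => hA ▸ Subfield.le_topologicalClosure _ ⟨f, rfl⟩
  have hiB : ∀ f, i' f ∈ B := fun f => hB ▸ Subfield.le_topologicalClosure _ ⟨f, rfl⟩
  have hAset : (A : Set Ω) = closure (Set.range i) := by
    rw [← hA, ← RingHom.coe_fieldRange]; rfl
  have hBset : (B : Set Ω) = closure (Set.range i') := by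
    rw [← hB, ← RingHom.coe_fieldRange]; rfl
  have hAc : IsClosed (A : Set Ω) := hAset ▸ isClosed_closure
  have hBc : IsClosed (B : Set Ω) := hBset ▸ isClosed_closure
  let j : F →+* A := i.codRestrict A hiA
  have hj : DenseRange j := by
    intro x
    rw [closure_subtype, ← Set.range_comp]
    exact hAset.subset x.2
  let _ : PseudoMetricSpace F := PseudoMetricSpace.induced j inferInstance
  have hjiso : Isometry j := Isometry.of_dist_eq fun _ _ => rfl
  have hiiso : Isometry i' := Isometry.of_dist_eq fun a b => by
    rw [dist_eq_norm, ← map_sub, hn, map_sub, ← dist_eq_norm]; rfl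
  let Φ : A →+* Ω :=
    IsDenseInducing.extendRingHom hjiso.isUniformInducing hj hiiso.uniformContinuous
  have hΦj : ∀ f, Φ (j f) = i' f :=
    IsDenseInducing.extend_eq (hjiso.isUniformInducing.isDenseInducing hj) hiiso.continuous
  have hΦc : Continuous Φ := (uniformContinuous_uniformly_extend hjiso.isUniformInducing hj
    hiiso.uniformContinuous).continuous
  have hΦn : ∀ x, ‖Φ x‖ = ‖(x : Ω)‖ := fun x =>
    hj.induction_on x (isClosed_eq hΦc.norm continuous_subtype_val.norm) fun f => by
      rw [hΦj, hn]; rfl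
  have hΦiso : Isometry Φ := Isometry.of_dist_eq fun a b => by
    rw [dist_eq_norm, ← map_sub, hΦn, Subtype.dist_eq, dist_eq_norm]; rfl
  have hΦB : ∀ x, Φ x ∈ B := fun x =>
    hj.induction_on x (hBc.preimage hΦc) fun f => by
      rw [hΦj]; exact hiB f
  have : CompleteSpace A := hAc.completeSpace_coe
  have hsurj : (B : Set Ω) ⊆ Set.range Φ := by
    rw [hBset]
    refine closure_minimal ?_ hΦiso.isClosedEmbedding.isClosed_range
    rintro _ ⟨f, rfl⟩
    exact ⟨j f, hΦj f⟩
  refine ⟨RingEquiv.ofBijective (Φ.codRestrict B hΦB) ⟨RingHom.injective _, fun y => ?_⟩,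
    hΦn, fun f _ => hΦj f⟩
  obtain ⟨x, hx⟩ := hsurj y.2
  exact ⟨x, Subtype.ext hx⟩

/-- A map out of `hatGen K {t}` is determined by its values on `K` and `t`. -/
lemma ringHom_hatGen_ext {K : Subfield Ω} {t : Ω} {f g : hatGen K ({t} : Set Ω) →+* Ω}
    (hf : Continuous f) (hg : Continuous g)
    (hK : ∀ (c : Ω) (hc : c ∈ K), f ⟨c, mem_hatGen_of_mem hc⟩ = g ⟨c, mem_hatGen_of_mem hc⟩)
    (ht : f ⟨t, mem_hatGen_of_mem_set (Set.mem_singleton t)⟩ =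
      g ⟨t, mem_hatGen_of_mem_set (Set.mem_singleton t)⟩) : f = g := by
  let E : Subfield Ω := (f.eqLocusField g).map (hatGen K {t}).subtype
  have hE : (E : Set Ω) = Subtype.val '' {x | f x = g x} := rfl
  have hEc : IsClosed (E : Set Ω) := by
    rw [hE]
    exact (Subfield.isClosed_topologicalClosure _).isClosedEmbedding_subtypeVal.isClosedMap _
      (isClosed_eq hf hg)
  have hle : hatGen K {t} ≤ E := by
    refine Subfield.topologicalClosure_minimal _ ?_ hEc
    rw [Subfield.closure_le]
    rintro x (hx | rfl)
    · exact ⟨⟨x, mem_hatGen_of_mem hx⟩, hK x hx, rfl⟩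
    · exact ⟨_, ht, rfl⟩
  ext x
  obtain ⟨y, hy, hyx⟩ := hle x.2
  obtain rfl : y = x := Subtype.ext hyx
  exact hy

/-- Lemma 3.1.3: if `|t - t'| < r_K(t)` then there is a unique isometric
`K`-isomorphism `φ : hat{K(t)} ≅ hat{K(t')}` with `φ(t) = t'`; moreover `φ` is an
`α`-perturbation of the identity embedding for any `α` with `|t-t'|/r_K(t) < α < 1`. -/
theorem primitive_perturbation (K : Subfield Ω) (hKc : IsClosed (K : Set Ω))
    (t t' : Ω) (h : dist t t' < rad K t) :
    ∃ φ : (hatGen K ({t} : Set Ω)) ≃+* (hatGen K ({t'} : Set Ω)),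
      (∀ x : hatGen K ({t} : Set Ω), ‖(φ x : Ω)‖ = ‖(x : Ω)‖) ∧
      (∀ (c : Ω) (hc : c ∈ K), (φ ⟨c, mem_hatGen_of_mem hc⟩ : Ω) = c) ∧
      (φ ⟨t, mem_hatGen_of_mem_set (Set.mem_singleton t)⟩ : Ω) = t' ∧
      (∀ α : ℝ, dist t t' / rad K t < α → α < 1 →
        ∀ x : hatGen K ({t} : Set Ω), x ≠ 0 → ‖(x : Ω) - (φ x : Ω)‖ < α * ‖(x : Ω)‖) ∧
      (∀ ψ : (hatGen K ({t} : Set Ω)) ≃+* (hatGen K ({t'} : Set Ω)),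
        (∀ x : hatGen K ({t} : Set Ω), ‖(ψ x : Ω)‖ = ‖(x : Ω)‖) →
        (∀ (c : Ω) (hc : c ∈ K), (ψ ⟨c, mem_hatGen_of_mem hc⟩ : Ω) = c) →
        (ψ ⟨t, mem_hatGen_of_mem_set (Set.mem_singleton t)⟩ : Ω) = t' → ψ = φ) := by
  have hr : 0 < rad K t := dist_nonneg.trans_lt h
  have hrad : ∀ a : Ω, IsAlgebraic K a → rad K t ≤ ‖t - a‖ := fun a ha => by
    rw [← dist_eq_norm]
    exact Metric.infDist_le_dist_of_mem ha
  obtain ⟨β, hβdef⟩ : ∃ β, β = dist t t' / rad K t := ⟨_, rfl⟩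
  have hβ0 : 0 ≤ β := hβdef ▸ div_nonneg dist_nonneg hr.le
  have hβ1 : β < 1 := hβdef ▸ (div_lt_one hr).2 h
  have hP := norm_eval₂_sub_eval₂_le K (t := t) (t' := t') hβ0 hβ1.le fun a ha => by
    calc dist t t' = β * rad K t := by rw [hβdef, div_mul_cancel₀ _ hr.ne']
      _ ≤ β * ‖t - a‖ := by gcongr; exact hrad a ha
  have hinj : Function.Injective (Polynomial.eval₂RingHom K.subtype t) := by
    rw [injective_iff_map_eq_zero]
    intro P hP0
    by_contra hne
    have := hrad t ⟨P, hne, hP0⟩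
    simp only [sub_self, norm_zero] at this
    exact this.not_gt hr
  have hinj' : Function.Injective (Polynomial.eval₂RingHom K.subtype t') := by
    rw [injective_iff_map_eq_zero]
    intro P hP0
    refine (injective_iff_map_eq_zero _).1 hinj P (norm_eq_zero.1 ?_)
    have := norm_eq_of_norm_sub_le hβ1 (hP P)
    rw [Polynomial.coe_eval₂RingHom] at hP0 ⊢
    rw [← this, hP0, norm_zero]
  let i : RatFunc K →+* Ω := IsFractionRing.lift hinj
  let i' : RatFunc K →+* Ω := IsFractionRing.lift hinj'
  have hi : ∀ P : Polynomial K, i (algebraMap _ _ P) = P.eval₂ K.subtype t :=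
    fun P => IsFractionRing.lift_algebraMap hinj P
  have hi' : ∀ P : Polynomial K, i' (algebraMap _ _ P) = P.eval₂ K.subtype t' :=
    fun P => IsFractionRing.lift_algebraMap hinj' P
  have hnear : ∀ f, ‖i f - i' f‖ ≤ β * ‖i f‖ := by
    intro f
    obtain ⟨P, Q, hQ, rfl⟩ := IsFractionRing.div_surjective (A := Polynomial K) f
    rw [map_div₀, map_div₀, hi, hi, hi', hi']
    refine norm_div_sub_div_le hβ1 (hP P) (hP Q) fun h0 => ?_
    exact nonZeroDivisors.ne_zero hQ ((injective_iff_map_eq_zero _).1 hinj Q h0)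
  have hA : i.fieldRange.topologicalClosure = hatGen K {t} := by
    rw [hatGen, ← fieldRange_lift_eval₂ K t hinj]
  have hB : i'.fieldRange.topologicalClosure = hatGen K {t'} := by
    rw [hatGen, ← fieldRange_lift_eval₂ K t' hinj']
  obtain ⟨φ, hφn, hφ⟩ := exists_isometric_ringEquiv_of_norm_eq i i'
    (fun f => norm_eq_of_norm_sub_le hβ1 (hnear f)) hA hB
  have hcont : ∀ ψ : (hatGen K ({t} : Set Ω)) ≃+* (hatGen K ({t'} : Set Ω)),
      (∀ x, ‖(ψ x : Ω)‖ = ‖(x : Ω)‖) → Continuous fun x => (ψ x : Ω) := fun ψ hψ =>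
    (Isometry.of_dist_eq fun a b => by
      rw [Subtype.dist_eq a b, dist_eq_norm, dist_eq_norm]
      simpa using hψ (a - b)).continuous
  have hφ_of_eq : ∀ (f : RatFunc K) (x : Ω) (_ : i f = x) (hx : x ∈ hatGen K {t}),
      (φ ⟨x, hx⟩ : Ω) = i' f := by
    rintro f _ rfl hx
    exact hφ f hx
  have hφK : ∀ (c : Ω) (hc : c ∈ K), (φ ⟨c, mem_hatGen_of_mem hc⟩ : Ω) = c := fun c hc => by
    rw [hφ_of_eq (algebraMap _ _ (Polynomial.C (⟨c, hc⟩ : K))) c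
      ((hi _).trans (Polynomial.eval₂_C _ _)), hi', Polynomial.eval₂_C]
    rfl
  have hφt : (φ ⟨t, mem_hatGen_of_mem_set (Set.mem_singleton t)⟩ : Ω) = t' := by
    rw [hφ_of_eq (algebraMap _ _ Polynomial.X) t
      ((hi _).trans (Polynomial.eval₂_X _ _)), hi', Polynomial.eval₂_X]
  refine ⟨φ, hφn, hφK, hφt, fun α hα _ x hx => ?_, fun ψ hψn hψK hψt => ?_⟩
  · have hle : ‖(x : Ω) - (φ x : Ω)‖ ≤ β * ‖(x : Ω)‖ := by
      have hx' : (x : Ω) ∈ closure (Set.range i) := by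
        rw [← RingHom.coe_fieldRange]
        exact hA.ge x.2
      obtain ⟨y, hy, hyx⟩ := mem_closure_iff_seq_limit.1 hx'
      choose f hf using hy
      have hmem : ∀ n, y n ∈ hatGen K {t} := fun n =>
        hA ▸ hf n ▸ Subfield.le_topologicalClosure _ ⟨f n, rfl⟩
      have hlim : Filter.Tendsto (fun n => (⟨y n, hmem n⟩ : hatGen K {t})) Filter.atTop
          (nhds x) := tendsto_subtype_rng.2 hyx
      refine le_of_tendsto_of_tendsto'
        ((hyx.sub (((hcont φ hφn).tendsto x).comp hlim)).norm) (hyx.norm.const_mul β) fun n => ?_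
      obtain rfl : y = fun n => i (f n) := funext fun n => (hf n).symm
      simpa [hφ] using hnear (f n)
    have hx0 : 0 < ‖(x : Ω)‖ := norm_pos_iff.2 fun h0 => hx (Subtype.ext h0)
    exact hle.trans_lt (mul_lt_mul_of_pos_right (hβdef ▸ hα) hx0)
  · have := ringHom_hatGen_ext
      (f := (hatGen K {t'}).subtype.comp (ψ : hatGen K {t} →+* hatGen K {t'}))
      (g := (hatGen K {t'}).subtype.comp (φ : hatGen K {t} →+* hatGen K {t'}))
      (hcont ψ hψn) (hcont φ hφn) (fun c hc => (hψK c hc).trans (hφK c hc).symm)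
      (hψt.trans hφt.symm)
    exact RingEquiv.ext fun x => Subtype.ext (RingHom.congr_fun this x)
end

section
/- Let L/K be an extension of analytic fields. If S ⊆ L is topgebraically independent over K and T ⊆ L is topgebraically generating over K, then |S| ≤ |T| (as cardinals). In particular, topdeg(L/K) ≤ Topdeg(L/K). -/
open Metric

set_option linter.unusedSectionVars false

/-!
Ambient setting: every extension of analytic (complete, non-archimedean, real-valued)
fields `L/K` embeds isometrically into an algebraically closed, complete,
non-archimedean normed field `Ω` (e.g. the completed algebraic closure of `L`).
We therefore formalize analytic fields as closed subfields of such an ambient field `Ω`.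
-/

variable {Ω : Type*} [NormedField Ω] [CompleteSpace Ω] [IsUltrametricDist Ω] [IsAlgClosed Ω]

namespace Topgebraic

/-- A polynomial over `A` has the same norm at two points `x`, `x'` that are closer to each other
than `x` is to any element algebraic over `A`. -/
lemma norm_aeval_eq {A : Type*} [CommRing A] [Algebra A Ω] [FaithfulSMul A Ω] {x x' : Ω}
    (h : ∀ w : Ω, IsAlgebraic A w → ‖x - x'‖ < ‖x - w‖) (q : Polynomial A) :
    ‖Polynomial.aeval x q‖ = ‖Polynomial.aeval x' q‖ := by
  by_cases hq : q = 0
  · simp [hq]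
  have key : ∀ w : Ω, IsAlgebraic A w → ‖x - w‖ = ‖x' - w‖ := fun w hw ↦ by
    have h1 : ‖(x - w) + -(x' - w)‖ < max ‖x - w‖ ‖-(x' - w)‖ := by
      rw [show (x - w) + -(x' - w) = x - x' by ring]
      exact (h w hw).trans_le (le_max_left _ _)
    simpa only [norm_neg] using IsUltrametricDist.norm_eq_of_add_norm_lt_max h1
  have hs := IsAlgClosed.splits (q.map (algebraMap A Ω))
  simp_rw [← Polynomial.eval_map_algebraMap, hs.eval_eq_prod_roots, norm_mul]
  congr 1
  simp only [← coe_nnnorm, NNReal.coe_inj]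
  rw [← nnnormHom_apply, ← nnnormHom_apply, map_multiset_prod, map_multiset_prod,
    Multiset.map_map, Multiset.map_map]
  congr 1
  refine Multiset.map_congr rfl fun w hw ↦ NNReal.eq ?_
  refine key w ⟨q, hq, ?_⟩
  simpa using (Polynomial.mem_roots'.mp hw).2

/-- If all roots of a polynomial have norm at least `s`, then its constant term dominates on the
disc of radius `s` around `0`. -/
lemma norm_coeff_mul_pow_le {Q : Polynomial Ω} {s : ℝ} (hs : 0 ≤ s)
    (h : ∀ z ∈ Q.roots, s ≤ ‖z‖) (k : ℕ) : ‖Q.coeff k‖ * s ^ k ≤ ‖Q.coeff 0‖ := by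
  suffices H : ∀ m : Multiset Ω, (∀ z ∈ m, s ≤ ‖z‖) → ∀ k,
      ‖((m.map fun a ↦ Polynomial.X - Polynomial.C a).prod).coeff k‖ * s ^ k ≤
        ‖((m.map fun a ↦ Polynomial.X - Polynomial.C a).prod).coeff 0‖ by
    rw [(IsAlgClosed.splits Q).eq_prod_roots, Polynomial.coeff_C_mul, Polynomial.coeff_C_mul,
      norm_mul, norm_mul, mul_assoc]
    exact mul_le_mul_of_nonneg_left (H _ h k) (norm_nonneg _)
  intro m
  induction m using Multiset.induction_on with
  | empty =>
    intro _ k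
    rcases k with _ | k <;> simp [Polynomial.coeff_one]
  | cons a m ih =>
    intro hm k
    have ha : s ≤ ‖a‖ := hm a (Multiset.mem_cons_self a m)
    have ih := ih fun z hz ↦ hm z (Multiset.mem_cons_of_mem hz)
    rw [Multiset.map_cons, Multiset.prod_cons]
    set p := (m.map fun a ↦ Polynomial.X - Polynomial.C a).prod
    rcases k with _ | k
    · simp
    have h0 : ‖((Polynomial.X - Polynomial.C a) * p).coeff 0‖ = ‖a‖ * ‖p.coeff 0‖ := by
      simp [sub_mul]
    have h1 : ((Polynomial.X - Polynomial.C a) * p).coeff (k + 1) =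
        p.coeff k - a * p.coeff (k + 1) := by
      simp [sub_mul]
    have h2 := ih k
    have h3 := ih (k + 1)
    have h4 : ‖p.coeff k - a * p.coeff (k + 1)‖ ≤ max ‖p.coeff k‖ ‖a * p.coeff (k + 1)‖ := by
      simpa [sub_eq_add_neg] using
        IsUltrametricDist.norm_add_le_max (p.coeff k) (-(a * p.coeff (k + 1)))
    rw [h0, h1]
    refine (mul_le_mul_of_nonneg_right h4 (by positivity)).trans ?_
    rw [max_mul_of_nonneg _ _ (by positivity), norm_mul]
    refine max_le ?_ ?_
    · calc ‖p.coeff k‖ * s ^ (k + 1) = s * (‖p.coeff k‖ * s ^ k) := by ring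
        _ ≤ ‖a‖ * ‖p.coeff 0‖ := by gcongr
    · rw [mul_assoc]
      gcongr

/-- If the constant term of a nonzero polynomial dominates on the disc of radius `s` around `0`,
then every root has norm at least `s`. -/
lemma le_norm_of_isRoot {Q : Polynomial Ω} (hQ : Q ≠ 0) {s : ℝ} (hs : 0 < s)
    (h : ∀ k, ‖Q.coeff k‖ * s ^ k ≤ ‖Q.coeff 0‖) {z : Ω} (hz : Q.eval z = 0) : s ≤ ‖z‖ := by
  by_contra! hlt
  have h0 : 0 < ‖Q.coeff 0‖ := by
    refine norm_pos_iff.mpr fun h0 ↦ hQ (Polynomial.ext fun k ↦ ?_)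
    have := h k
    rw [h0, norm_zero] at this
    simpa using nonpos_of_mul_nonpos_left this (pow_pos hs k)
  have hterm : ∀ k, ‖Q.coeff (k + 1) * z ^ (k + 1)‖ < ‖Q.coeff 0‖ := fun k ↦ by
    rw [norm_mul, norm_pow]
    rcases (norm_nonneg (Q.coeff (k + 1))).eq_or_lt with hc | hc
    · rwa [← hc, zero_mul]
    · refine lt_of_lt_of_le ?_ (h (k + 1))
      gcongr
  rw [Polynomial.eval_eq_sum_range, Finset.sum_range_succ'] at hz
  obtain ⟨k, -, hk⟩ := IsUltrametricDist.exists_norm_finsetSum_le (Finset.range Q.natDegree)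
    fun k ↦ Q.coeff (k + 1) * z ^ (k + 1)
  refine (hk.trans_lt (hterm k)).ne ?_
  rw [eq_neg_of_add_eq_zero_left hz]
  simp

/-- Let `y` be at distance at least `s` from every element algebraic over `R[x]`. If `x'` is closer
to `x` than every element algebraic over `R[y]`, then `y` is at distance at least `s` from every
element algebraic over `R[x']`. -/
lemma le_norm_sub_of_isAlgebraic_adjoin_singleton {R : Type*} [CommRing R] [IsDomain R]
    [Algebra R Ω] {x x' y : Ω} {s : ℝ} (hs : 0 < s)
    (hx : ∀ w : Ω, IsAlgebraic (Algebra.adjoin R {y}) w → ‖x - x'‖ < ‖x - w‖)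
    (hy : ∀ z : Ω, IsAlgebraic (Algebra.adjoin R {x}) z → s ≤ ‖y - z‖)
    {z : Ω} (hz : IsAlgebraic (Algebra.adjoin R {x'}) z) : s ≤ ‖y - z‖ := by
  obtain ⟨p, hp, hpz⟩ := hz
  have ev (t : Ω) : ∃ f : Polynomial R →+* Algebra.adjoin R {t}, Function.Surjective f ∧
      (algebraMap (Algebra.adjoin R {t}) Ω).comp f = (Polynomial.aeval t : _ →ₐ[R] Ω) := by
    refine ⟨((Polynomial.aeval (⟨t, Algebra.self_mem_adjoin_singleton R t⟩ :
      Algebra.adjoin R {t})) : _ →ₐ[R] _), ?_, ?_⟩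
    · rintro ⟨a, ha⟩
      obtain ⟨q, rfl⟩ := by simpa [Algebra.adjoin_singleton_eq_range_aeval] using ha
      refine ⟨q, Subtype.ext ?_⟩
      simp
    · ext <;> simp
  obtain ⟨f', hf', hf'c⟩ := ev x'
  obtain ⟨f, -, hfc⟩ := ev x
  obtain ⟨P, rfl⟩ := Polynomial.map_surjective f' hf' p
  set A := Algebra.adjoin R {y}
  let y' : A := ⟨y, Algebra.self_mem_adjoin_singleton R y⟩
  let Q : Polynomial (Polynomial A) :=
    Polynomial.taylor (Polynomial.C y') (P.map (Polynomial.mapRingHom (algebraMap R A)))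
  have hQ (t : Ω) : Q.map ((Polynomial.aeval t : _ →ₐ[A] Ω) : _ →+* Ω) =
      Polynomial.taylor y (P.map (Polynomial.aeval t : _ →ₐ[R] Ω)) := by
    have : ((Polynomial.aeval t : _ →ₐ[A] Ω) : Polynomial A →+* Ω).comp
        (Polynomial.mapRingHom (algebraMap R A)) = (Polynomial.aeval t : _ →ₐ[R] Ω) := by
      ext <;> simp
    rw [Polynomial.map_taylor, Polynomial.map_map, this]
    simp [y']
  have hcoeff (k : ℕ) : ‖(Q.map ((Polynomial.aeval x : _ →ₐ[A] Ω) : _ →+* Ω)).coeff k‖ =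
      ‖(Q.map ((Polynomial.aeval x' : _ →ₐ[A] Ω) : _ →+* Ω)).coeff k‖ := by
    simpa using norm_aeval_eq hx (Q.coeff k)
  have hinj (t : Ω) : Function.Injective (algebraMap (Algebra.adjoin R {t}) Ω) :=
    Subtype.val_injective
  have hne' : Q.map ((Polynomial.aeval x' : _ →ₐ[A] Ω) : _ →+* Ω) ≠ 0 := by
    rw [hQ, ← hf'c, ← Polynomial.map_map, Ne, Polynomial.taylor_eq_zero,
      Polynomial.map_eq_zero_iff (hinj x')]
    exact hp
  have hne : Q.map ((Polynomial.aeval x : _ →ₐ[A] Ω) : _ →+* Ω) ≠ 0 := fun h ↦ hne' <| by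
    ext k
    simpa [h] using (hcoeff k).symm
  have hdom : ∀ k, ‖(Q.map ((Polynomial.aeval x : _ →ₐ[A] Ω) : _ →+* Ω)).coeff k‖ * s ^ k ≤
      ‖(Q.map ((Polynomial.aeval x : _ →ₐ[A] Ω) : _ →+* Ω)).coeff 0‖ := by
    refine norm_coeff_mul_pow_le hs.le fun w hw ↦ ?_
    have hw := (Polynomial.mem_roots hne).mp hw
    rw [hQ, Polynomial.IsRoot, Polynomial.taylor_eval, ← hfc, ← Polynomial.map_map,
      Polynomial.eval_map_algebraMap] at hw
    have := hy (w + y) ⟨P.map f, fun h0 ↦ hne ?_, hw⟩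
    · simpa using this
    · rw [hQ, ← hfc, ← Polynomial.map_map, h0]
      simp
  simp_rw [hcoeff] at hdom
  rw [norm_sub_rev]
  refine le_norm_of_isRoot hne' hs hdom ?_
  rw [hQ, Polynomial.taylor_eval, sub_add_cancel, ← hf'c, ← Polynomial.map_map,
    Polynomial.eval_map_algebraMap]
  exact hpz

/-- Moving every `x i` with `i ∈ u` by less than `δ i` does not bring any member of the family `x`
closer than `δ` to the elements algebraic over the others. -/
lemma le_norm_sub_piecewise {K : Subfield Ω} {ι : Type*} [DecidableEq ι] {x x' : ι → Ω}
    {δ : ι → ℝ} (hδ : ∀ i, 0 < δ i)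
    (hx : ∀ i w, IsAlgebraic (Algebra.adjoin K (x '' {i}ᶜ)) w → δ i ≤ ‖x i - w‖)
    (hx' : ∀ i, ‖x i - x' i‖ < δ i) (u : Finset ι) (i : ι) (w : Ω)
    (hw : IsAlgebraic (Algebra.adjoin K (u.piecewise x' x '' {i}ᶜ)) w) :
    δ i ≤ ‖u.piecewise x' x i - w‖ := by
  induction u using Finset.induction_on generalizing i w with
  | empty =>
    rw [Finset.piecewise_empty] at hw ⊢
    exact hx i w hw
  | insert j u hj ih =>
    rw [Finset.piecewise_insert] at hw ⊢
    set v := u.piecewise x' x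
    have hvj : v j = x j := Finset.piecewise_eq_of_notMem _ _ _ hj
    by_cases hij : i = j
    · subst hij
      have himg : Function.update v i (x' i) '' {i}ᶜ = v '' {i}ᶜ :=
        Set.image_congr fun k hk ↦ Function.update_of_ne hk _ _
      rw [himg] at hw
      have h1 := ih i w hw
      rw [hvj] at h1
      rw [Function.update_self]
      have h2 : ‖(x i - w) + -(x' i - w)‖ < max ‖x i - w‖ ‖-(x' i - w)‖ := by
        rw [show (x i - w) + -(x' i - w) = x i - x' i by ring]
        exact ((hx' i).trans_le h1).trans_le (le_max_left _ _)
      have h3 := IsUltrametricDist.norm_eq_of_add_norm_lt_max h2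
      rw [norm_neg] at h3
      exact h3 ▸ h1
    · rw [Function.update_of_ne hij]
      let R := Algebra.adjoin K (v '' {i, j}ᶜ)
      have tower (t : Ω) (s : Set Ω) (hs : s = v '' {i, j}ᶜ ∪ {t}) (z : Ω) :
          IsAlgebraic (Algebra.adjoin K s) z ↔ IsAlgebraic (Algebra.adjoin R {t}) z := by
        rw [hs, Algebra.adjoin_union_eq_adjoin_adjoin]
        rfl
      have hi : v '' {j}ᶜ = v '' {i, j}ᶜ ∪ {v i} := by
        rw [← Set.image_singleton, ← Set.image_union]
        congr 1
        ext k
        by_cases hk : k = i <;> simp [hk, hij]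
      have hj1 : v '' {i}ᶜ = v '' {i, j}ᶜ ∪ {v j} := by
        rw [← Set.image_singleton, ← Set.image_union]
        congr 1
        ext k
        by_cases hk : k = j <;> simp [hk, Ne.symm hij]
      have hj2 : Function.update v j (x' j) '' {i}ᶜ = v '' {i, j}ᶜ ∪ {x' j} := by
        have : Function.update v j (x' j) '' {i, j}ᶜ = v '' {i, j}ᶜ :=
          Set.image_congr fun k hk ↦ Function.update_of_ne (by simp at hk; exact hk.2) _ _
        rw [← this]
        nth_rw 3 [← Function.update_self j (x' j) v]
        rw [← Set.image_singleton, ← Set.image_union]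
        congr 1
        ext k
        by_cases hk : k = j <;> simp [hk, Ne.symm hij]
      refine le_norm_sub_of_isAlgebraic_adjoin_singleton (R := R) (x := v j) (x' := x' j) (hδ i)
        (fun w hw ↦ ?_) (fun z hz ↦ ih i z ((tower _ _ hj1 z).mpr hz)) ((tower _ _ hj2 w).mp hw)
      refine lt_of_lt_of_le ?_ (ih j w ((tower _ _ hi w).mpr hw))
      rw [hvj]
      exact hx' j

/-- A family whose members stay at distance at least `δ` from the elements algebraic over the
others is algebraically independent, and remains so after moving each member by less than `δ`. -/
lemma algebraicIndependent_of_norm_sub_lt {K : Subfield Ω} {ι : Type*} {x x' : ι → Ω}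
    {δ : ι → ℝ} (hδ : ∀ i, 0 < δ i)
    (hx : ∀ i w, IsAlgebraic (Algebra.adjoin K (x '' {i}ᶜ)) w → δ i ≤ ‖x i - w‖)
    (hx' : ∀ i, ‖x i - x' i‖ < δ i) : AlgebraicIndependent K x' := by
  classical
  refine algebraicIndependent_of_finite_type' (algebraMap K Ω).injective
    fun t ht _ i hi halg ↦ ?_
  let u := insert i ht.toFinset
  have hu : ∀ k ∈ u, u.piecewise x' x k = x' k := fun k hk ↦ Finset.piecewise_eq_of_mem _ _ _ hk
  have hsub : x' '' t ⊆ u.piecewise x' x '' {i}ᶜ := by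
    rintro _ ⟨k, hk, rfl⟩
    exact ⟨k, fun h ↦ hi (h ▸ hk), hu k (by simp [u, hk])⟩
  have := le_norm_sub_piecewise hδ hx hx' u i (x' i)
    (halg.adjoin_of_forall_isAlgebraic fun a ha ↦ (ha.2 (hsub ha.1)).elim)
  rw [hu i (Finset.mem_insert_self _ _), sub_self, norm_zero] at this
  exact (hδ i).not_ge this

/-- If `F` is dense in `E`, then every element algebraic over `E` is a limit of elements algebraic
over `F`. -/
lemma exists_isAlgebraic_norm_sub_lt {F E : Type*} [Field F] [NormedField E] [Algebra F E]
    [NormedAlgebra E Ω] [Algebra F Ω] [IsScalarTower F E Ω] (hd : DenseRange (algebraMap F E))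
    {a : Ω} (ha : IsAlgebraic E a) {η : ℝ} (hη : 0 < η) :
    ∃ b, IsAlgebraic F b ∧ ‖a - b‖ < η := by
  have hf : (minpoly E a).Monic := minpoly.monic ha.isIntegral
  have hfa : (minpoly E a).aeval a = 0 := minpoly.aeval _ _
  have hf0 : (minpoly E a).natDegree ≠ 0 := (minpoly.natDegree_pos ha.isIntegral).ne'
  generalize minpoly E a = f at hf hfa hf0
  have hε : 0 < (η / max ‖a‖ 1) ^ f.natDegree / (f.natDegree + 1) := by positivity
  obtain ⟨g, hg, hdeg, hcoeff⟩ :=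
    Polynomial.exists_monic_and_natDegree_eq_and_norm_map_algebraMap_coeff_sub_lt hd hf hε
  obtain ⟨b, hb, hab⟩ := Polynomial.exists_aroots_norm_sub_lt_of_norm_coeff_sub_lt hε hfa hf
    (hg.map _) (hdeg ▸ g.natDegree_map _) hcoeff (IsAlgClosed.splits _)
  refine ⟨b, ⟨g, hg.ne_zero, ?_⟩, ?_⟩
  · simpa using (Polynomial.mem_aroots.mp hb).2
  · rwa [mul_div_cancel₀ _ (by positivity), Real.pow_rpow_inv_natCast (by positivity) hf0,
      div_mul_cancel₀ _ (by positivity)] at hab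

/-- An element algebraic over the completion of `M` is a limit of elements algebraic over `M`. -/
lemma mem_closure_of_isAlgebraic_topologicalClosure {M : Subfield Ω} {a : Ω}
    (ha : IsAlgebraic M.topologicalClosure a) : a ∈ closure {z : Ω | IsAlgebraic M z} := by
  let : Algebra M M.topologicalClosure :=
    (Subfield.inclusion M.le_topologicalClosure).toAlgebra
  have : IsScalarTower M M.topologicalClosure Ω := .of_algebraMap_eq fun _ ↦ rfl
  let : NormedAlgebra M.topologicalClosure Ω :=
    { norm_smul_le := fun c b ↦ norm_mul_le (c : Ω) b }
  have hd : DenseRange (algebraMap M M.topologicalClosure) := by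
    refine Metric.denseRange_iff.mpr fun b r hr ↦ ?_
    obtain ⟨m, hm, hbm⟩ := Metric.mem_closure_iff.mp b.2 r hr
    exact ⟨⟨m, hm⟩, hbm⟩
  refine Metric.mem_closure_iff.mpr fun η hη ↦ ?_
  obtain ⟨b, hb, hab⟩ := exists_isAlgebraic_norm_sub_lt hd ha hη
  exact ⟨b, hb, by rwa [dist_eq_norm]⟩

/-- Algebraicity over the subfield generated by `K` and `T` is algebraicity over `K[T]`. -/
lemma isAlgebraic_adjoin_of_isAlgebraic_subfieldClosure {K : Subfield Ω} {T : Set Ω} {a : Ω}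
    (ha : IsAlgebraic (Subfield.closure ((K : Set Ω) ∪ T)) a) :
    IsAlgebraic (Algebra.adjoin K T) a := by
  have h : (IntermediateField.adjoin K T).toSubfield = Subfield.closure ((K : Set Ω) ∪ T) := by
    rw [IntermediateField.adjoin_toSubfield]
    congr 2
    exact Subtype.range_coe
  rw [← h] at ha
  exact IntermediateField.isAlgebraic_adjoin_iff.mp ha

lemma exists_isAlgebraic_adjoin_norm_sub_lt {K L : Subfield Ω} {T : Set Ω}
    (hT : TopgebraicallyGenerates K L T) {a : Ω} (ha : a ∈ L) {ε : ℝ} (hε : 0 < ε) :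
    ∃ b, IsAlgebraic (Algebra.adjoin K T) b ∧ ‖a - b‖ < ε := by
  have hsub : {x : Ω | IsAlgebraic (hatGen K T) x} ⊆
      closure {x : Ω | IsAlgebraic (Subfield.closure ((K : Set Ω) ∪ T)) x} :=
    fun x hx ↦ mem_closure_of_isAlgebraic_topologicalClosure hx
  obtain ⟨b, hb, hab⟩ :=
    Metric.mem_closure_iff.mp (closure_minimal hsub isClosed_closure (hT ha)) ε hε
  exact ⟨b, isAlgebraic_adjoin_of_isAlgebraic_subfieldClosure hb, by rwa [← dist_eq_norm]⟩

lemma exists_pos_forall_le_norm_sub {K : Subfield Ω} {S : Set Ω} (hS : TopgebraicIndep K S)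
    {a : Ω} (ha : a ∈ S) :
    ∃ δ > 0, ∀ w, IsAlgebraic (Algebra.adjoin K (S \ {a})) w → δ ≤ ‖a - w‖ := by
  have h := hS a ha
  rw [TopTranscendental, IsTopgebraicElem, Metric.mem_closure_iff] at h
  push Not at h
  obtain ⟨δ, hδ, h⟩ := h
  refine ⟨δ, hδ, fun w hw ↦ dist_eq_norm a w ▸ h w ?_⟩
  have hle : (Algebra.adjoin K (S \ {a})).toSubring ≤ (hatGen K (S \ {a})).toSubring := by
    rw [Algebra.adjoin_eq_ring_closure, Subring.closure_le]
    rintro _ (⟨c, rfl⟩ | hb)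
    · exact mem_hatGen_of_mem c.2
    · exact mem_hatGen_of_mem_set hb
  obtain ⟨p, hp, hpw⟩ := hw
  refine ⟨p.map (Subring.inclusion hle), ?_, ?_⟩
  · rwa [Ne, Polynomial.map_eq_zero_iff (Subring.inclusion_injective hle)]
  · rw [Polynomial.aeval_def, Polynomial.eval₂_map]
    exact hpw

lemma cardinalMk_le_of_isAlgebraic_adjoin {K : Subfield Ω} {S T : Set Ω} {x : S → Ω}
    (hx : AlgebraicIndependent K x) (hT : ∀ i, IsAlgebraic (Algebra.adjoin K T) (x i)) :
    Cardinal.mk S ≤ Cardinal.mk T := by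
  rw [← Cardinal.mk_range_eq x hx.injective]
  let M := AlgebraicIndependent.matroid K Ω
  have hind : M.Indep (Set.range x) := hx.to_subtype_range
  have hsub : Set.range x ⊆ M.closure T := by
    rw [AlgebraicIndependent.matroid_closure_eq]
    rintro _ ⟨i, rfl⟩
    exact hT i
  calc _ ≤ M.cRk (M.closure T) := hind.cardinalMk_le_cRk_of_subset hsub
    _ = M.cRk T := M.cRk_closure T
    _ ≤ Cardinal.mk T := M.cRk_le_cardinalMk T

lemma cardinalMk_le_of_topgebraicIndep_of_topgebraicallyGenerates {K L : Subfield Ω}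
    {S T : Set Ω} (hSL : S ⊆ L) (hS : TopgebraicIndep K S)
    (hT : TopgebraicallyGenerates K L T) : Cardinal.mk S ≤ Cardinal.mk T := by
  choose δ hδ hsep using fun i : S ↦ exists_pos_forall_le_norm_sub hS i.2
  choose x' halg hx' using fun i : S ↦
    exists_isAlgebraic_adjoin_norm_sub_lt hT (hSL i.2) (hδ i)
  refine cardinalMk_le_of_isAlgebraic_adjoin
    (algebraicIndependent_of_norm_sub_lt (x := Subtype.val) hδ (fun i w hw ↦ hsep i w ?_) hx') halg
  have himg : ((↑) : S → Ω) '' {i}ᶜ = S \ {↑i} := by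
    ext a
    simp [and_comm]
  rwa [himg] at hw

end Topgebraic

/-- Theorem 3.2.1, the main inequality: if `S ⊆ L` is topgebraically
independent over `K` and `T ⊆ L` is topgebraically generating over `K`, then `|S| ≤ |T|`.
In particular `topdeg(L/K) ≤ Topdeg(L/K)`. -/
theorem topgebraicIndep_card_le_generating (K L : Subfield Ω)
    (hKc : IsClosed (K : Set Ω)) (hLc : IsClosed (L : Set Ω)) (hKL : K ≤ L) :
    (∀ S T : Set Ω, S ⊆ (L : Set Ω) → T ⊆ (L : Set Ω) →
      TopgebraicIndep K S → TopgebraicallyGenerates K L T →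
      Cardinal.mk S ≤ Cardinal.mk T) ∧
    topdeg K L ≤ Topdeg K L := by
  have main : ∀ S T : Set Ω, S ⊆ (L : Set Ω) → T ⊆ (L : Set Ω) →
      TopgebraicIndep K S → TopgebraicallyGenerates K L T →
      Cardinal.mk S ≤ Cardinal.mk T := fun S T hSL _ hS hT ↦
    Topgebraic.cardinalMk_le_of_topgebraicIndep_of_topgebraicallyGenerates hSL hS hT
  refine ⟨main, ?_⟩
  have hL : TopgebraicallyGenerates K L L := fun a ha ↦ subset_closure <|
    isAlgebraic_algebraMap (⟨a, mem_hatGen_of_mem_set ha⟩ : hatGen K L)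
  have : Nonempty {T : Set Ω // T ⊆ (L : Set Ω) ∧ TopgebraicallyGenerates K L T} :=
    ⟨⟨L, subset_rfl, hL⟩⟩
  exact ciSup_le' fun S ↦ le_ciInf fun T ↦ main S T S.2.1 T.2.1 S.2.2 T.2.2
end
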